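/- arXiv:2207.14283 — 14 statements merged into one kernel-verified Lean document; each statement's English description precedes it below -/
import Mathlib

section
/- Let R be a (possibly noncommutative, possibly nonunital) ring in which every nilpotent element is central and has finite additive order. Then R is nilperiod; that is, for every nonzero nilpotent element r of R there exists a positive integer n such that (x + r)^n = x^n for all x in R. -/
/-- Power map for positive exponents in a (possibly nonunital) ring:
`nupow x n = x^n` for `n ≥ 1` (with junk value `0` at `n = 0`). -/
def nupow {R : Type*} [NonUnitalRing R] (x : R) : ℕ → R
  | 0 => 0
  | 1 => x
  | n + 2 => nupow x (n + 1) * x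

/-- In the unitization, `nupow` is the usual power map. -/
theorem inr_nupow {R : Type*} [NonUnitalRing R] (x : R) {n : ℕ} (hn : 0 < n) :
    ((nupow x n : R) : Unitization ℤ R) = (x : Unitization ℤ R) ^ n := by
  induction n, hn using Nat.le_induction with
  | base => simp [nupow]
  | succ n hn ih =>
    obtain ⟨m, rfl⟩ : ∃ m, n = m + 1 := ⟨n - 1, by omega⟩
    rw [pow_succ, ← ih, ← Unitization.inr_mul]
    rfl

theorem Nat.dvd_choose_mul_factorial {j k i : ℕ} (hi : 0 < i) (hik : i ≤ k) :
    j ∣ (j * k.factorial).choose i := by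
  obtain ⟨c, hc⟩ := Nat.dvd_factorial hi hik
  obtain ⟨i, rfl⟩ : ∃ m, i = m + 1 := ⟨i - 1, by omega⟩
  rcases Nat.eq_zero_or_pos (j * k.factorial) with h | h
  · simp [h]
  obtain ⟨n, hn⟩ : ∃ n, j * k.factorial = n + 1 := ⟨j * k.factorial - 1, by omega⟩
  have key := Nat.add_one_mul_choose_eq n i
  rw [← hn, hc] at key
  rw [hc]
  refine ⟨c * n.choose i, Nat.eq_of_mul_eq_mul_right hi ?_⟩
  rw [← key]
  ring

/-- Adding a commuting nilpotent element of finite additive order does not change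
a suitable power. -/
theorem Commute.add_pow_mul_factorial_eq {A : Type*} [Semiring A] {x r : A} (h : Commute r x)
    {j k : ℕ} (hk : r ^ k = 0) (hj : j • r = 0) :
    (x + r) ^ (j * k.factorial) = x ^ (j * k.factorial) := by
  rw [add_comm, h.add_pow, Finset.sum_range_succ', Finset.sum_eq_zero]
  · simp
  intro i _
  rcases le_total k (i + 1) with hi | hi
  · rw [pow_eq_zero_of_le hi hk]
    simp
  · obtain ⟨c, hc⟩ := Nat.dvd_choose_mul_factorial (j := j) i.succ_pos hi
    rw [hc, (Nat.cast_commute _ _).symm.eq, ← mul_assoc, pow_succ', ← mul_assoc, Nat.cast_mul,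
      (Nat.cast_commute j (c : A)).eq, mul_assoc (c : A), ← nsmul_eq_mul j, hj]
    simp

/-- If every nilpotent element of a (not necessarily commutative or unital) ring `R`
is central and has finite additive order, then `R` is nilperiod: every nonzero
nilpotent `r` is a period of some power map `x ↦ x^n`. -/
theorem stmt0 {R : Type*} [NonUnitalRing R]
    (hcen : ∀ r : R, (∃ k : ℕ, 0 < k ∧ nupow r k = 0) → ∀ x : R, r * x = x * r)
    (htor : ∀ r : R, (∃ k : ℕ, 0 < k ∧ nupow r k = 0) → ∃ j : ℕ, 0 < j ∧ j • r = 0) :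
    ∀ r : R, r ≠ 0 → (∃ k : ℕ, 0 < k ∧ nupow r k = 0) →
      ∃ n : ℕ, 0 < n ∧ ∀ x : R, nupow (x + r) n = nupow x n := by
  rintro r - ⟨k, hk, hrk⟩
  obtain ⟨j, hj, hjr⟩ := htor r ⟨k, hk, hrk⟩
  have hn : 0 < j * k.factorial := Nat.mul_pos hj k.factorial_pos
  refine ⟨j * k.factorial, hn, fun x ↦ Unitization.inr_injective (R := ℤ) ?_⟩
  rw [inr_nupow _ hn, inr_nupow _ hn, Unitization.inr_add]
  refine Commute.add_pow_mul_factorial_eq (A := Unitization ℤ R) ?_ ?_ ?_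
  · rw [commute_iff_eq, ← Unitization.inr_mul, ← Unitization.inr_mul, hcen r ⟨k, hk, hrk⟩ x]
  · rw [← inr_nupow r hk, hrk, Unitization.inr_zero]
  · rw [← Unitization.inr_smul, hjr, Unitization.inr_zero]
end

section
/- Let R be a weakly periodic ring in which every nilpotent element is central and has finite additive order. Then R is a periodic commutative torsion ring: the multiplication of R is commutative, for every x in R there exist positive integers m and n with x^{m+n} = x^m, and every element of R has finite additive order. -/
/-- If `f α` is a non-central root of unity of a division ring, some element conjugates it to a
different power of itself. -/
theorem exists_mul_root_eq_pow_mul {K D : Type*} [CommRing K] [IsDomain K] [DivisionRing D]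
    (f : K →+* D) (hf : Function.Injective f) {α : K} {m : ℕ} [NeZero m]
    (hα : IsPrimitiveRoot α m) {y : D} (hy : y * f α ≠ f α * y) :
    ∃ w : D, ∃ i : ℕ, w * f α = f α ^ i * w ∧ w * f α ≠ f α * w := by
  classical
  by_contra! hcon
  let : Module K D := Module.compHom D f
  have smul_eq (k : K) (z : D) : k • z = f k * z := rfl
  let T : Module.End K D :=
    { toFun := fun z => z * f α
      map_add' := fun u v => add_mul u v _
      map_smul' := fun k z => by simp [smul_eq, mul_assoc] }
  have T_apply (z : D) : T z = z * f α := rfl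
  have T_pow (n : ℕ) (z : D) : (T ^ n) z = z * f α ^ n := by
    induction n generalizing z with
    | zero => simp
    | succ n ih => rw [pow_succ, Module.End.mul_apply, ih, T_apply, pow_succ', mul_assoc]
  have aeval_linear (ζ : K) (z : D) :
      Polynomial.aeval T (Polynomial.X - Polynomial.C ζ) z = z * f α - f ζ * z := by
    simp [T_apply, smul_eq, Module.algebraMap_end_apply]
  have hinj : Function.Injective (Polynomial.aeval T
      (∏ ζ ∈ (Polynomial.nthRootsFinset m (1 : K)).erase α,
        (Polynomial.X - Polynomial.C ζ))) := by
    refine Finset.prod_induction _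
      (fun q : Polynomial K => Function.Injective (Polynomial.aeval T q)) ?_ ?_ ?_
    · intro p q hp hq
      rw [map_mul, Module.End.mul_eq_comp, LinearMap.coe_comp]
      exact hp.comp hq
    · rw [map_one]
      exact fun _ _ h => h
    · intro ζ hζ
      rw [injective_iff_map_eq_zero]
      intro w hw
      obtain ⟨hne, hmem⟩ := Finset.mem_erase.mp hζ
      obtain ⟨i, -, rfl⟩ := hα.eq_pow_of_pow_eq_one
        ((Polynomial.mem_nthRootsFinset (NeZero.pos m) _).mp hmem)
      rw [aeval_linear, sub_eq_zero] at hw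
      have hw' := hcon w i (by rw [hw, map_pow])
      by_contra hw0
      exact hne (hf (mul_right_cancel₀ hw0 (hw.symm.trans hw')))
  apply hy
  rw [← sub_eq_zero, ← aeval_linear]
  apply hinj
  rw [← Module.End.mul_apply, ← map_mul, Finset.prod_erase_mul _ _
    ((Polynomial.mem_nthRootsFinset (NeZero.pos m) _).mpr hα.pow_eq_one),
    ← Polynomial.X_pow_sub_one_eq_prod (NeZero.pos m) hα, map_zero]
  rw [map_sub, map_pow, Polynomial.aeval_X, map_one, LinearMap.sub_apply, T_pow, ← map_pow,
    hα.pow_eq_one]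
  simp

/-- Elements `a`, `w` of finite multiplicative order with `w * a = a ^ i * w` generate a finite
monoid. -/
theorem Submonoid.finite_closure_pair {M : Type*} [Monoid M] {a w : M} {i : ℕ}
    (ha : IsOfFinOrder a) (hw : IsOfFinOrder w) (h : w * a = a ^ i * w) :
    (Submonoid.closure {a, w} : Set M).Finite := by
  have hcomm (j k : ℕ) : w ^ j * a ^ k = a ^ (i ^ j * k) * w ^ j := by
    have h1 (k : ℕ) : w * a ^ k = a ^ (i * k) * w := by
      have : SemiconjBy w a (a ^ i) := h
      simpa [pow_mul] using (this.pow_right k).eq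
    induction j generalizing k with
    | zero => simp
    | succ j ih => rw [pow_succ, mul_assoc, h1, ← mul_assoc, ih, mul_assoc, pow_succ, mul_assoc]
  let N : Submonoid M :=
    { carrier := {x | ∃ p q : ℕ, a ^ p * w ^ q = x}
      one_mem' := ⟨0, 0, by simp⟩
      mul_mem' := by
        rintro _ _ ⟨p, q, rfl⟩ ⟨r, s, rfl⟩
        refine ⟨p + i ^ q * r, q + s, ?_⟩
        rw [mul_assoc (a ^ p) (w ^ q), ← mul_assoc (w ^ q), hcomm]
        simp only [mul_assoc, pow_add] }
  have hN : (N : Set M).Finite := by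
    refine (((Finset.range (orderOf a) ×ˢ Finset.range (orderOf w)).finite_toSet).image
      (fun t : ℕ × ℕ => a ^ t.1 * w ^ t.2)).subset ?_
    rintro _ ⟨p, q, rfl⟩
    exact ⟨(p % orderOf a, q % orderOf w),
      by simp [Nat.mod_lt, ha.orderOf_pos, hw.orderOf_pos], by simp [pow_mod_orderOf]⟩
  refine hN.subset ?_
  change Submonoid.closure _ ≤ N
  rw [Submonoid.closure_le]
  rintro x (rfl | rfl)
  · exact ⟨1, 0, by simp⟩
  · exact ⟨0, 1, by simp⟩

/-- Jacobson's theorem for division rings. -/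
theorem DivisionRing.mul_comm_of_pow_eq_self {D : Type*} [DivisionRing D]
    (h : ∀ x : D, ∃ n : ℕ, 1 < n ∧ x ^ n = x) (x y : D) : x * y = y * x := by
  have hfin (x : D) (hx : x ≠ 0) : IsOfFinOrder x := by
    obtain ⟨n, hn, hxn⟩ := h x
    refine isOfFinOrder_iff_pow_eq_one.mpr ⟨n - 1, by omega, mul_right_cancel₀ hx ?_⟩
    rw [← pow_succ, Nat.sub_add_cancel hn.le, hxn, one_mul]
  obtain ⟨p, hp⟩ := CharP.exists D
  have hp0 : p ≠ 0 := by
    rintro rfl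
    have := CharP.charP_to_charZero D
    obtain ⟨n, hn, h2⟩ := h 2
    have h2' : (2 : ℕ) ^ n = 2 := by exact_mod_cast h2
    have := Nat.pow_lt_pow_right (a := 2) one_lt_two hn
    omega
  have hprime : Fact p.Prime := ⟨(CharP.char_is_prime_or_zero D p).resolve_right hp0⟩
  let := ZMod.algebra D p
  by_contra hxy
  have hy0 : y ≠ 0 := by rintro rfl; simp at hxy
  let C := Subring.centralizer ({y} : Set D)
  let yC : C := ⟨y, by simp [C, Subring.mem_centralizer_iff]⟩
  let yK : Subring.center C := ⟨yC, by
    rw [Subring.mem_center_iff]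
    rintro ⟨g, hg⟩
    exact Subtype.ext ((Subring.mem_centralizer_iff.mp hg y rfl).symm)⟩
  let f : Subring.center C →+* D := C.subtype.comp (Subring.center C).subtype
  have hf : Function.Injective f := Subtype.val_injective.comp Subtype.val_injective
  have hord : 0 < orderOf yK := by
    have : orderOf (f yK) = orderOf yK := orderOf_injective (f : _ →* D) hf yK
    rw [← this]
    exact (hfin y hy0).orderOf_pos
  have : NeZero (orderOf yK) := ⟨hord.ne'⟩
  obtain ⟨w, i, hwi, hwy⟩ := exists_mul_root_eq_pow_mul f hf (IsPrimitiveRoot.orderOf yK)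
    (y := x) hxy
  change w * y = y ^ i * w at hwi
  change w * y ≠ y * w at hwy
  have hw0 : w ≠ 0 := by rintro rfl; simp at hwy
  have hclosure := Submonoid.finite_closure_pair (hfin y hy0) (hfin w hw0) hwi
  let B := Algebra.adjoin (ZMod p) ({y, w} : Set D)
  have : Module.Finite (ZMod p) B := by
    change Module.Finite (ZMod p) (Subalgebra.toSubmodule B)
    rw [Algebra.adjoin_eq_span]
    exact Module.Finite.span_of_finite _ hclosure
  have : Finite B := Module.finite_of_finite (ZMod p)
  have hB : IsField B := Finite.isDomain_to_isField B
  have := hB.mul_comm ⟨w, Algebra.subset_adjoin (by simp)⟩ ⟨y, Algebra.subset_adjoin (by simp)⟩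
  exact hwy (congrArg Subtype.val this)

theorem nupow_succ {R : Type*} [NonUnitalRing R] (x : R) {n : ℕ} (hn : 0 < n) :
    nupow x (n + 1) = nupow x n * x := by
  obtain ⟨k, rfl⟩ := Nat.exists_eq_add_of_le' hn
  rfl

theorem map_nupow {R S : Type*} [NonUnitalRing R] [NonUnitalRing S] (f : R →ₙ+* S) (x : R) :
    ∀ n : ℕ, f (nupow x n) = nupow (f x) n
  | 0 => map_zero f
  | 1 => rfl
  | n + 2 => by simp only [nupow, map_mul, map_nupow f x (n + 1)]

theorem nupow_eq_pow {R : Type*} [Ring R] (x : R) {n : ℕ} (hn : 0 < n) : nupow x n = x ^ n := by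
  induction n, hn using Nat.le_induction with
  | base => exact (pow_one x).symm
  | succ n hn ih => rw [nupow_succ x hn, ih, pow_succ]

/-- A potent element generates an idempotent. -/
theorem exists_idempotent_of_nupow_eq_self {R : Type*} [NonUnitalRing R] {x : R} {m : ℕ}
    (hm : 1 < m) (hx : nupow x m = x) :
    ∃ e u : R, e * e = e ∧ e * x = x ∧ x * e = x ∧ e = u * x ∧ e = x * u := by
  obtain ⟨k, rfl⟩ := Nat.exists_eq_add_of_le' hm
  have hX : (x : Unitization ℤ R) ^ (k + 2) = x := by rw [← inr_nupow x (by omega), hx]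
  have hinj := Unitization.inr_injective (R := ℤ) (A := R)
  refine ⟨nupow x (k + 1), nupow x (2 * k + 1), hinj ?_, hinj ?_, hinj ?_, hinj ?_, hinj ?_⟩
  · rw [Unitization.inr_mul, inr_nupow x (by omega)]
    calc (x : Unitization ℤ R) ^ (k + 1) * x ^ (k + 1) = x ^ (k + 2) * x ^ k := by
          rw [← pow_add, ← pow_add]
          congr 1
          omega
      _ = x ^ (k + 1) := by rw [hX, pow_succ']
  · rw [Unitization.inr_mul, inr_nupow x (by omega), ← pow_succ, hX]
  · rw [Unitization.inr_mul, inr_nupow x (by omega), ← pow_succ', hX]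
  · rw [Unitization.inr_mul, inr_nupow x (by omega), inr_nupow x (by omega)]
    calc (x : Unitization ℤ R) ^ (k + 1) = x * x ^ k := pow_succ' _ _
      _ = x ^ (k + 2) * x ^ k := by rw [hX]
      _ = x ^ (2 * k + 1) * x := by
        rw [← pow_add, ← pow_succ]
        congr 1
        omega
  · rw [Unitization.inr_mul, inr_nupow x (by omega), inr_nupow x (by omega)]
    calc (x : Unitization ℤ R) ^ (k + 1) = x * x ^ k := pow_succ' _ _
      _ = x ^ (k + 2) * x ^ k := by rw [hX]
      _ = x * x ^ (2 * k + 1) := by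
        rw [← pow_add, ← pow_succ']
        congr 1
        omega

/-- Jacobson's theorem for rings without zero divisors. -/
theorem mul_comm_of_potent_of_noZeroDivisors {D : Type*} [NonUnitalRing D] [NoZeroDivisors D]
    (h : ∀ x : D, ∃ m : ℕ, 1 < m ∧ nupow x m = x) (x y : D) : x * y = y * x := by
  by_cases hx : x = 0
  · simp [hx]
  obtain ⟨m, hm, hxm⟩ := h x
  obtain ⟨e, -, hee, hex, -⟩ := exists_idempotent_of_nupow_eq_self hm hxm
  have he : e ≠ 0 := by
    rintro rfl
    exact hx (by rw [← hex, zero_mul])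
  have left_id {f : D} (hf : f ≠ 0) (hff : f * f = f) (z : D) : f * z = z := by
    rw [← sub_eq_zero]
    refine (mul_eq_zero.mp ?_).resolve_left hf
    rw [mul_sub, ← mul_assoc, hff, sub_self]
  have right_id {f : D} (hf : f ≠ 0) (hff : f * f = f) (z : D) : z * f = z := by
    rw [← sub_eq_zero]
    refine (mul_eq_zero.mp ?_).resolve_right hf
    rw [sub_mul, mul_assoc, hff, sub_self]
  let ring : Ring D :=
    { (inferInstance : NonUnitalRing D) with
      one := e
      one_mul := left_id he hee
      mul_one := right_id he hee }
  have : Nontrivial D := ⟨e, 0, he⟩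
  have hunit (z : D) : IsUnit z ∨ z = 0 := by
    by_cases hz : z = 0
    · exact Or.inr hz
    left
    obtain ⟨n, hn, hzn⟩ := h z
    obtain ⟨f, u, hff, hfz, -, hfu, hfu'⟩ := exists_idempotent_of_nupow_eq_self hn hzn
    have hf : f ≠ 0 := by
      rintro rfl
      exact hz (by rw [← hfz, zero_mul])
    have hfe : f = e := (right_id he hee f).symm.trans (left_id hf hff e)
    exact ⟨⟨z, u, hfu'.symm.trans hfe, hfu.symm.trans hfe⟩, rfl⟩
  let div : DivisionRing D := DivisionRing.ofIsUnitOrEqZero hunit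
  refine DivisionRing.mul_comm_of_pow_eq_self (fun z => ?_) x y
  obtain ⟨n, hn, hzn⟩ := h z
  exact ⟨n, hn, (nupow_eq_pow z (by omega)).symm.trans hzn⟩

/-- Every two-sided ideal is the kernel of a surjection. -/
theorem TwoSidedIdeal.exists_quotient.{u} {S : Type u} [NonUnitalRing S]
    (I : TwoSidedIdeal S) :
    ∃ (Q : Type u) (_ : NonUnitalRing Q) (f : S →ₙ+* Q),
      Function.Surjective f ∧ ∀ x, f x = 0 ↔ x ∈ I :=
  ⟨I.ringCon.Quotient, inferInstance,
    { toFun := fun x => (x : I.ringCon.Quotient)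
      map_mul' := fun _ _ => rfl
      map_zero' := rfl
      map_add' := fun _ _ => rfl },
    Quotient.mk''_surjective, fun _ => (RingCon.eq _).trans (I.mem_iff _).symm⟩

/-- There is a two-sided ideal maximal among those avoiding a given nonzero element. -/
theorem TwoSidedIdeal.exists_maximal_notMem {S : Type*} [NonUnitalRing S] {c : S} (hc : c ≠ 0) :
    ∃ I : TwoSidedIdeal S, Maximal (fun J => c ∉ J) I := by
  suffices h : ∀ C ⊆ {I : TwoSidedIdeal S | c ∉ I}, IsChain (· ≤ ·) C →
      ∀ I ∈ C, ∃ J ∈ {I : TwoSidedIdeal S | c ∉ I}, ∀ K ∈ C, K ≤ J by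
    obtain ⟨I, -, hI⟩ := zorn_le_nonempty₀ _ h ⊥ (by simpa [TwoSidedIdeal.mem_bot] using hc)
    exact ⟨I, hI⟩
  intro C hC hchain I hI
  refine ⟨TwoSidedIdeal.mk' {x | ∃ J ∈ C, x ∈ J} ⟨I, hI, I.zero_mem⟩ ?_ ?_ ?_ ?_, ?_, ?_⟩
  · rintro x y ⟨J, hJ, hx⟩ ⟨K, hK, hy⟩
    rcases hchain.total hJ hK with h | h
    · exact ⟨K, hK, K.add_mem (h hx) hy⟩
    · exact ⟨J, hJ, J.add_mem hx (h hy)⟩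
  · rintro x ⟨J, hJ, hx⟩
    exact ⟨J, hJ, J.neg_mem hx⟩
  · rintro x y ⟨J, hJ, hy⟩
    exact ⟨J, hJ, J.mul_mem_left _ _ hy⟩
  · rintro x y ⟨J, hJ, hx⟩
    exact ⟨J, hJ, J.mul_mem_right _ _ hx⟩
  · rw [Set.mem_ofPred_eq, TwoSidedIdeal.mem_mk']
    rintro ⟨J, hJ, hx⟩
    exact hC hJ hx
  · intro J hJ x hx
    exact (TwoSidedIdeal.mem_mk' _ _ _ _ _ _ _).mpr ⟨J, hJ, hx⟩

/-- A ring of potent elements has no zero divisors if some nonzero element is fixed by every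
nonzero central idempotent. -/
theorem noZeroDivisors_of_potent {D : Type*} [NonUnitalRing D]
    (h : ∀ x : D, ∃ m : ℕ, 1 < m ∧ nupow x m = x) {c : D} (hc : c ≠ 0)
    (hfix : ∀ e : D, e ≠ 0 → e * e = e → (∀ x, e * x = x * e) → e * c = c) :
    NoZeroDivisors D := by
  have hsq {x : D} (hx : x * x = 0) : x = 0 := by
    obtain ⟨m, hm, hxm⟩ := h x
    obtain ⟨e, u, -, hex, -, heu, -⟩ := exists_idempotent_of_nupow_eq_self hm hxm
    rw [← hex, heu, mul_assoc, hx, mul_zero]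
  have hcentral {e : D} (he : e * e = e) (x : D) : e * x = x * e := by
    have h1 : e * x - e * x * e = 0 := hsq (by
      have : (e * x - e * x * e) * e = 0 := by rw [sub_mul, mul_assoc _ e, he, sub_self]
      calc (e * x - e * x * e) * (e * x - e * x * e)
          = (e * x - e * x * e) * e * (x - x * e) := by
            simp only [mul_sub, mul_assoc]
        _ = 0 := by rw [this, zero_mul])
    have h2 : x * e - e * x * e = 0 := hsq (by
      have : e * (x * e - e * x * e) = 0 := by
        simp only [mul_sub, ← mul_assoc, he, sub_self]
      calc (x * e - e * x * e) * (x * e - e * x * e)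
          = (x - e * x) * (e * (x * e - e * x * e)) := by
            simp only [sub_mul, mul_assoc]
        _ = 0 := by rw [this, mul_zero])
    rw [sub_eq_zero.mp h1, sub_eq_zero.mp h2]
  refine ⟨fun {x y} hxy => ?_⟩
  by_contra! hne
  obtain ⟨m, hm, hxm⟩ := h x
  obtain ⟨e, u, hee, hex, -, heu, -⟩ := exists_idempotent_of_nupow_eq_self hm hxm
  obtain ⟨n, hn, hyn⟩ := h y
  obtain ⟨f, v, hff, hfy, -, -, hfv⟩ := exists_idempotent_of_nupow_eq_self hn hyn
  have he : e ≠ 0 := by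
    rintro rfl
    exact hne.1 (by rw [← hex, zero_mul])
  have hf : f ≠ 0 := by
    rintro rfl
    exact hne.2 (by rw [← hfy, zero_mul])
  apply hc
  calc c = e * (f * c) := by rw [hfix f hf hff (hcentral hff), hfix e he hee (hcentral hee)]
    _ = u * (x * y) * v * c := by rw [heu, hfv]; simp only [mul_assoc]
    _ = 0 := by simp [hxy]

/-- Jacobson's theorem: a ring in which every element is potent is commutative. -/
theorem mul_comm_of_potent {S : Type*} [NonUnitalRing S]
    (h : ∀ x : S, ∃ m : ℕ, 1 < m ∧ nupow x m = x) (x y : S) : x * y = y * x := by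
  by_contra hxy
  obtain ⟨I, hI⟩ := TwoSidedIdeal.exists_maximal_notMem (sub_ne_zero.mpr hxy)
  obtain ⟨D, _, f, hf, hker⟩ := I.exists_quotient
  have hD (z : D) : ∃ m : ℕ, 1 < m ∧ nupow z m = z := by
    obtain ⟨z, rfl⟩ := hf z
    obtain ⟨m, hm, hz⟩ := h z
    exact ⟨m, hm, by rw [← map_nupow, hz]⟩
  have hc : f (x * y - y * x) ≠ 0 := fun h0 => hI.1 ((hker _).mp h0)
  have : NoZeroDivisors D := by
    refine noZeroDivisors_of_potent hD hc fun e he hee hecomm => ?_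
    obtain ⟨e, rfl⟩ := hf e
    let J : TwoSidedIdeal S := .mk' {z | f e * f z = f z} (by simp)
      (fun {a b} ha hb => by
        simp only [Set.mem_ofPred_eq, map_add, mul_add] at *
        rw [ha, hb])
      (fun {a} ha => by
        simp only [Set.mem_ofPred_eq, map_neg, mul_neg] at *
        rw [ha])
      (fun {a b} hb => by
        simp only [Set.mem_ofPred_eq, map_mul] at *
        rw [← mul_assoc, hecomm, mul_assoc, hb])
      (fun {a b} ha => by
        simp only [Set.mem_ofPred_eq, map_mul] at *
        rw [← mul_assoc, ha])
    have hmem (z : S) : z ∈ J ↔ f e * f z = f z := TwoSidedIdeal.mem_mk' _ _ _ _ _ _ _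
    have hIJ : I ≤ J := fun z hz => (hmem z).mpr (by rw [(hker z).mpr hz, mul_zero])
    by_contra hcon
    have hJI := hI.2 (y := J) (fun hcJ => hcon ((hmem _).mp hcJ)) hIJ
    exact he ((hker e).mpr (hJI ((hmem e).mpr hee)))
  apply hc
  rw [map_sub, map_mul, map_mul, mul_comm_of_potent_of_noZeroDivisors hD, sub_self]

theorem pow_add_mul_eq_of_pow_eq_self {M : Type*} [Monoid M] {x : M} {m : ℕ} (hm : 1 < m)
    (hx : x ^ m = x) {n : ℕ} (hn : 0 < n) (r : ℕ) : x ^ (n + (m - 1) * r) = x ^ n := by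
  induction r with
  | zero => simp
  | succ r ih =>
    have h1 : n + (m - 1) * (r + 1) = m + (n - 1 + (m - 1) * r) := by
      rw [mul_add, mul_one]
      omega
    rw [h1, pow_add, hx, ← pow_succ', ← ih]
    congr 1
    omega

theorem IsNilpotent.eq_zero_of_pow_eq_self {M : Type*} [MonoidWithZero M] {x : M}
    (hnil : IsNilpotent x) {m : ℕ} (hm : 1 < m) (hx : x ^ m = x) : x = 0 := by
  obtain ⟨k, hk⟩ := hnil
  have h := pow_add_mul_eq_of_pow_eq_self hm hx one_pos k
  rw [pow_one] at h
  rw [← h]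
  exact pow_eq_zero_of_le (le_add_left (Nat.le_mul_of_pos_left k (by omega))) hk

theorem isNilpotent_inr_iff {R : Type*} [NonUnitalRing R] (x : R) :
    IsNilpotent (x : Unitization ℤ R) ↔ ∃ k : ℕ, 0 < k ∧ nupow x k = 0 := by
  constructor
  · rintro ⟨k, hk⟩
    refine ⟨k + 1, k.succ_pos, Unitization.inr_injective (R := ℤ) ?_⟩
    rw [inr_nupow x k.succ_pos, pow_succ, hk, zero_mul, Unitization.inr_zero]
  · rintro ⟨k, hk, hx⟩
    exact ⟨k, by rw [← inr_nupow x hk, hx, Unitization.inr_zero]⟩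

/-- If `d` is nilpotent and torsion, then passing to a suitable power absorbs `d`. -/
theorem Commute.add_pow_mul_factorial {A : Type*} [Ring A] {x d : A} (h : Commute x d) {j k : ℕ}
    (hd : d ^ k = 0) (hj : j • d = 0) :
    (x + d) ^ (j * k.factorial) = x ^ (j * k.factorial) := by
  rw [h.add_pow, Finset.sum_eq_single (j * k.factorial)]
  · simp
  · intro i hi hne
    rw [Finset.mem_range] at hi
    set n := j * k.factorial with hn
    by_cases hk : k ≤ n - i
    · rw [pow_eq_zero_of_le hk hd, mul_zero, zero_mul]
    obtain ⟨l, hl⟩ : ∃ l, n - i = l + 1 := ⟨n - i - 1, by omega⟩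
    obtain ⟨q, hq⟩ := Nat.dvd_factorial (m := l + 1) (n := k) l.succ_pos (by omega)
    have hchoose : n.choose i = j * (q * (n - 1).choose l) := by
      rw [← Nat.choose_symm (by omega), hl]
      refine Nat.eq_of_mul_eq_mul_right l.succ_pos ?_
      have := Nat.add_one_mul_choose_eq (n - 1) l
      rw [Nat.sub_add_cancel (by omega)] at this
      rw [Nat.succ_eq_add_one, ← this, hn, hq]
      ring
    have hjd : d * (j : A) = 0 := by rw [← nsmul_eq_mul', hj]
    rw [hl, hchoose, pow_succ, Nat.cast_mul, mul_assoc, mul_assoc (d ^ l), ← mul_assoc d, hjd]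
    simp
  · simp

theorem mul_eq_add_nsmul_of_commute {A : Type*} [Ring A] {x y c : A} (hc : Commute c x)
    (h : x * y = y * x + c) (n : ℕ) :
    x ^ (n + 1) * y = y * x ^ (n + 1) + (n + 1) • (x ^ n * c) := by
  induction n with
  | zero => simp [h]
  | succ n ih =>
    have h1 : x ^ n * c * x = x ^ (n + 1) * c := by rw [mul_assoc, hc.eq, ← mul_assoc, pow_succ]
    rw [pow_succ x (n + 1), mul_assoc, h, mul_add, ← mul_assoc, ih, add_mul, smul_mul_assoc, h1,
      mul_assoc, add_assoc, succ_nsmul _ (n + 1)]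

/-- In a ring in which every element is potent, every element has finite additive order. -/
theorem exists_nsmul_eq_zero_of_potent {S : Type*} [NonUnitalRing S]
    (h : ∀ z : S, ∃ m : ℕ, 1 < m ∧ nupow z m = z) (z : S) : ∃ j : ℕ, 0 < j ∧ j • z = 0 := by
  obtain ⟨m, hm, hz⟩ := h z
  obtain ⟨n, hn, h2z⟩ := h (2 • z)
  have hz' : (z : Unitization ℤ S) ^ m = z := by rw [← inr_nupow z (by omega), hz]
  have h2z' : ((2 • z : S) : Unitization ℤ S) ^ n = (2 • z : S) := by
    rw [← inr_nupow _ (by omega), h2z]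
  have h1 := pow_add_mul_eq_of_pow_eq_self hm hz' one_pos (n - 1)
  have h2 := pow_add_mul_eq_of_pow_eq_self hn h2z' one_pos (m - 1)
  rw [mul_comm (n - 1), Unitization.inr_smul, smul_pow, h1, pow_one] at h2
  have hk : 2 < 2 ^ (1 + (m - 1) * (n - 1)) := by
    have : 0 < (m - 1) * (n - 1) := Nat.mul_pos (by omega) (by omega)
    calc 2 = 2 ^ 1 := rfl
      _ < _ := Nat.pow_lt_pow_right one_lt_two (by omega)
  refine ⟨2 ^ (1 + (m - 1) * (n - 1)) - 2, by omega, ?_⟩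
  refine Unitization.inr_injective (R := ℤ) ?_
  rw [Unitization.inr_smul, Unitization.inr_zero, sub_nsmul _ hk.le, h2, pow_one, add_neg_cancel]

/-- A potent element of prime additive order is fixed by arbitrarily large powers of the
Frobenius map. -/
theorem exists_nupow_prime_pow_eq_self {S : Type*} [NonUnitalRing S]
    (h : ∀ z : S, ∃ m : ℕ, 1 < m ∧ nupow z m = z) {p : ℕ} (hp : p.Prime) {z : S}
    (hpz : p • z = 0) (v : ℕ) : ∃ t : ℕ, v ≤ t ∧ nupow z (p ^ t) = z := by
  obtain ⟨m, hm, hz⟩ := h z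
  have hZ : (z : Unitization ℤ S) ^ m = z := by rw [← inr_nupow z (by omega), hz]
  have : NeZero (m - 1) := ⟨by omega⟩
  obtain ⟨i, i', hlt, heq⟩ : ∃ i i' : ℕ, i < i' ∧
      ((p ^ (i * (v + 1)) : ℕ) : ZMod (m - 1)) = (p ^ (i' * (v + 1)) : ℕ) := by
    obtain ⟨a, b, hne, hab⟩ := Finite.exists_ne_map_eq_of_infinite
      (fun i : ℕ => ((p ^ (i * (v + 1)) : ℕ) : ZMod (m - 1)))
    rcases hne.lt_or_gt with hlt | hlt
    · exact ⟨a, b, hlt, hab⟩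
    · exact ⟨b, a, hlt, hab.symm⟩
  obtain ⟨l, rfl⟩ := Nat.exists_eq_add_of_lt hlt
  set s := i * (v + 1)
  set t := (l + 1) * (v + 1) with ht
  have hst : (i + l + 1) * (v + 1) = t + s := by simp only [s, t]; ring
  rw [hst] at heq
  have hle : p ^ s ≤ p ^ (t + s) := Nat.pow_le_pow_right hp.pos (by omega)
  obtain ⟨r, hr⟩ := (Nat.modEq_iff_dvd' hle).mp ((ZMod.natCast_eq_natCast_iff _ _ _).mp heq)
  have hpow : (z : Unitization ℤ S) ^ p ^ (t + s) = z ^ p ^ s := by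
    rw [show p ^ (t + s) = p ^ s + (m - 1) * r by omega,
      pow_add_mul_eq_of_pow_eq_self hm hZ (Nat.pow_pos hp.pos)]
  refine ⟨t, by rw [ht]; nlinarith, ?_⟩
  have hd : IsNilpotent ((z - nupow z (p ^ t) : S) : Unitization ℤ S) := by
    rw [Unitization.inr_sub, inr_nupow z (Nat.pow_pos hp.pos)]
    refine ⟨p ^ s, ?_⟩
    have hcomm : Commute ((z : Unitization ℤ S) - z ^ p ^ t) (z ^ p ^ t) :=
      ((Commute.refl _).pow_right _).sub_left (Commute.refl _)
    have hpZ : (p : Unitization ℤ S) * (z : Unitization ℤ S) = 0 := by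
      rw [← nsmul_eq_mul, ← Unitization.inr_smul, hpz, Unitization.inr_zero]
    obtain ⟨r, hr⟩ :=
      Commute.exists_add_pow_prime_pow_eq (R := Unitization ℤ S) hp hcomm s
    have hpd : (p : Unitization ℤ S) * ((z : Unitization ℤ S) - z ^ p ^ t) = 0 := by
      obtain ⟨q, hq⟩ := Nat.exists_eq_add_of_le' (Nat.pow_pos (n := t) hp.pos)
      rw [mul_sub, hpZ, hq, pow_succ', ← mul_assoc, hpZ, zero_mul, sub_zero]
    rw [sub_add_cancel, ← pow_mul, ← pow_add, hpow, hpd, zero_mul, zero_mul, add_zero] at hr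
    exact right_eq_add.mp hr
  obtain ⟨n, hn, hdn⟩ := h (z - nupow z (p ^ t))
  have hd0 := IsNilpotent.eq_zero_of_pow_eq_self (M := Unitization ℤ S) hd hn
    (by rw [← inr_nupow _ (by omega), hdn])
  rw [← Unitization.inr_zero ℤ] at hd0
  exact (sub_eq_zero.mp (Unitization.inr_injective hd0)).symm

/-- In a weakly periodic ring with central nilpotent elements, the nilpotent elements form an
ideal, modulo which every element is potent. -/
theorem exists_potent_quotient.{u} {R : Type u} [NonUnitalRing R]
    (hwp : ∀ x : R, ∃ a b : R, x = a + b ∧ (∃ k : ℕ, 0 < k ∧ nupow a k = 0) ∧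
      (∃ m : ℕ, 1 < m ∧ nupow b m = b))
    (hcen : ∀ r : R, (∃ k : ℕ, 0 < k ∧ nupow r k = 0) → ∀ x : R, r * x = x * r) :
    ∃ (S : Type u) (_ : NonUnitalRing S) (f : R →ₙ+* S),
      (∀ x, f x = 0 ↔ ∃ k : ℕ, 0 < k ∧ nupow x k = 0) ∧
      ∀ z : S, ∃ m : ℕ, 1 < m ∧ nupow z m = z := by
  have hcomm {x : R} (hx : IsNilpotent (x : Unitization ℤ R)) (y : R) :
      Commute (x : Unitization ℤ R) y := by
    rw [commute_iff_eq, ← Unitization.inr_mul, hcen x ((isNilpotent_inr_iff x).mp hx),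
      Unitization.inr_mul]
  let N : TwoSidedIdeal R := .mk' {x | IsNilpotent (x : Unitization ℤ R)}
    (IsNilpotent.zero (R := Unitization ℤ R))
    (fun {x y} hx hy => by
      rw [Set.mem_ofPred_eq, Unitization.inr_add]
      exact Commute.isNilpotent_add (R := Unitization ℤ R) (hcomm hx y) hx hy)
    (fun {x} hx => by
      rw [Set.mem_ofPred_eq, Unitization.inr_neg]
      exact IsNilpotent.neg (R := Unitization ℤ R) hx)
    (fun {x y} hy => by
      rw [Set.mem_ofPred_eq, Unitization.inr_mul]
      exact Commute.isNilpotent_mul_left (R := Unitization ℤ R) (hcomm hy x).symm hy)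
    (fun {x y} hx => by
      rw [Set.mem_ofPred_eq, Unitization.inr_mul]
      exact Commute.isNilpotent_mul_right (R := Unitization ℤ R) (hcomm hx y) hx)
  obtain ⟨S, _, f, hf, hker⟩ := N.exists_quotient
  have hker' (x : R) : f x = 0 ↔ ∃ k : ℕ, 0 < k ∧ nupow x k = 0 :=
    (hker x).trans ((TwoSidedIdeal.mem_mk' _ _ _ _ _ _ _).trans (isNilpotent_inr_iff x))
  refine ⟨S, _, f, hker', fun z => ?_⟩
  obtain ⟨x, rfl⟩ := hf z
  obtain ⟨a, b, rfl, ha, m, hm, hb⟩ := hwp x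
  exact ⟨m, hm, by rw [map_add, (hker' a).mpr ha, zero_add, ← map_nupow, hb]⟩

/-- If the nilpotent elements are central and every element is potent modulo the nilpotent
elements, then elements of prime power additive order are central. -/
theorem mul_comm_of_prime_pow_nsmul_eq_zero {R S : Type*} [NonUnitalRing R] [NonUnitalRing S]
    (f : R →ₙ+* S) (hker : ∀ x, f x = 0 ↔ ∃ k : ℕ, 0 < k ∧ nupow x k = 0)
    (hpot : ∀ z : S, ∃ m : ℕ, 1 < m ∧ nupow z m = z)
    (hcen : ∀ r : R, f r = 0 → ∀ x : R, r * x = x * r) {p v : ℕ} (hp : p.Prime) {x : R}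
    (hx : p ^ v • x = 0) (y : R) : x * y = y * x := by
  have hpx : p • f x = 0 := by
    rw [← map_nsmul, hker, ← isNilpotent_inr_iff]
    refine ⟨v + 1, ?_⟩
    rw [Unitization.inr_smul, smul_pow, pow_succ, pow_succ', mul_comm, mul_smul,
      ← smul_mul_assoc (p ^ v), ← Unitization.inr_smul, hx]
    simp
  obtain ⟨t, hvt, ht⟩ := exists_nupow_prime_pow_eq_self hpot hp hpx v
  have hd : f (x - nupow x (p ^ t)) = 0 := by rw [map_sub, map_nupow, ht, sub_self]
  have hc : f (x * y - y * x) = 0 := by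
    rw [map_sub, map_mul, map_mul, mul_comm_of_potent hpot, sub_self]
  have hpow : nupow x (p ^ t) * y = y * nupow x (p ^ t) := by
    refine Unitization.inr_injective (R := ℤ) ?_
    obtain ⟨q, hq⟩ := Nat.exists_eq_add_of_le' (Nat.pow_pos (n := t) hp.pos)
    have hcX : Commute ((x * y - y * x : R) : Unitization ℤ R) x := by
      rw [commute_iff_eq, ← Unitization.inr_mul, hcen _ hc, Unitization.inr_mul]
    have hxy : (x : Unitization ℤ R) * y = y * x + (x * y - y * x : R) := by
      rw [Unitization.inr_sub, Unitization.inr_mul, Unitization.inr_mul, add_sub_cancel]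
    have htc : p ^ t • (x * y - y * x) = 0 := by
      obtain ⟨w, rfl⟩ := Nat.exists_eq_add_of_le' hvt
      rw [pow_add, mul_smul, smul_sub, ← smul_mul_assoc, ← mul_smul_comm, hx]
      simp
    rw [Unitization.inr_mul, Unitization.inr_mul, inr_nupow x (Nat.pow_pos hp.pos), hq,
      mul_eq_add_nsmul_of_commute (A := Unitization ℤ R) hcX hxy, ← mul_smul_comm, ← hq,
      ← Unitization.inr_smul, htc]
    simp
  have h := hcen _ hd y
  rwa [sub_mul, mul_sub, hpow, sub_left_inj] at h

/-- If the nilpotent elements are central and every element is potent modulo the nilpotent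
elements, then elements of finite additive order are central. -/
theorem mul_comm_of_nsmul_eq_zero {R S : Type*} [NonUnitalRing R] [NonUnitalRing S]
    (f : R →ₙ+* S) (hker : ∀ x, f x = 0 ↔ ∃ k : ℕ, 0 < k ∧ nupow x k = 0)
    (hpot : ∀ z : S, ∃ m : ℕ, 1 < m ∧ nupow z m = z)
    (hcen : ∀ r : R, f r = 0 → ∀ x : R, r * x = x * r) {j : ℕ} (hj : 0 < j) {x : R}
    (hx : j • x = 0) (y : R) : x * y = y * x := by
  induction j using Nat.recOnPosPrimePosCoprime generalizing x with
  | zero => exact absurd hj (lt_irrefl 0)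
  | one => simp [(one_nsmul x).symm.trans hx]
  | prime_pow p n hp _ => exact mul_comm_of_prime_pow_nsmul_eq_zero f hker hpot hcen hp hx y
  | coprime a b ha hb hab iha ihb =>
    have h1 : (b • x) * y = y * (b • x) := iha (by omega) (by rw [← mul_smul, hx])
    have h2 : (a • x) * y = y * (a • x) := ihb (by omega) (by rw [← mul_smul, mul_comm, hx])
    have hbez : x = Nat.gcdA a b • (a • x) + Nat.gcdB a b • (b • x) := by
      have := Nat.gcd_eq_gcd_ab a b
      rw [hab.gcd_eq_one] at this
      rw [← natCast_zsmul x a, ← natCast_zsmul x b, ← mul_smul, ← mul_smul, ← add_smul,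
        mul_comm _ (a : ℤ), mul_comm _ (b : ℤ), ← this, Nat.cast_one, one_smul]
    rw [hbez]
    simp only [add_mul, mul_add, smul_mul_assoc, mul_smul_comm] at h1 h2 ⊢
    rw [h1, h2]

/-- A weakly periodic ring (every element is a sum of a nilpotent and a potent element)
in which every nilpotent element is central and has finite additive order is a
periodic commutative torsion ring. -/
theorem stmt2 {R : Type*} [NonUnitalRing R]
    (hwp : ∀ x : R, ∃ a b : R, x = a + b ∧ (∃ k : ℕ, 0 < k ∧ nupow a k = 0) ∧
      (∃ m : ℕ, 1 < m ∧ nupow b m = b))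
    (hcen : ∀ r : R, (∃ k : ℕ, 0 < k ∧ nupow r k = 0) → ∀ x : R, r * x = x * r)
    (htor : ∀ r : R, (∃ k : ℕ, 0 < k ∧ nupow r k = 0) → ∃ j : ℕ, 0 < j ∧ j • r = 0) :
    (∀ x y : R, x * y = y * x) ∧
    (∀ x : R, ∃ m n : ℕ, 0 < m ∧ 0 < n ∧ nupow x (m + n) = nupow x m) ∧
    (∀ x : R, ∃ j : ℕ, 0 < j ∧ j • x = 0) := by
  obtain ⟨S, _, f, hker, hpot⟩ := exists_potent_quotient hwp hcen
  have torsion (x : R) : ∃ j : ℕ, 0 < j ∧ j • x = 0 := by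
    obtain ⟨i, hi, hix⟩ := exists_nsmul_eq_zero_of_potent hpot (f x)
    obtain ⟨j, hj, hjx⟩ := htor (i • x) ((hker _).mp (by rw [map_nsmul, hix]))
    exact ⟨j * i, Nat.mul_pos hj hi, by rw [mul_smul, hjx]⟩
  refine ⟨fun x y => ?_, fun x => ?_, torsion⟩
  · obtain ⟨j, hj, hjx⟩ := torsion x
    exact mul_comm_of_nsmul_eq_zero f hker hpot (fun r hr => hcen r ((hker r).mp hr)) hj hjx y
  · obtain ⟨m, hm, hmx⟩ := hpot (f x)
    have hnil : ∃ k : ℕ, 0 < k ∧ nupow (nupow x m - x) k = 0 :=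
      (hker _).mp (by rw [map_sub, map_nupow, hmx, sub_self])
    obtain ⟨j, hj, hjd⟩ := htor _ hnil
    obtain ⟨k, hk, hkd⟩ := hnil
    have hm0 : 0 < m := by omega
    have hn : 0 < j * k.factorial := Nat.mul_pos hj k.factorial_pos
    refine ⟨j * k.factorial, (m - 1) * (j * k.factorial), hn,
      Nat.mul_pos (by omega) hn, Unitization.inr_injective (R := ℤ) ?_⟩
    have hcomm : Commute (x : Unitization ℤ R) (nupow x m - x : R) := by
      rw [Unitization.inr_sub, inr_nupow x hm0]
      exact ((Commute.refl _).pow_right m).sub_right (Commute.refl _)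
    have h := Commute.add_pow_mul_factorial (A := Unitization ℤ R) hcomm (j := j) (k := k)
      (by rw [← inr_nupow _ hk, hkd, Unitization.inr_zero])
      (by rw [← Unitization.inr_smul, hjd, Unitization.inr_zero])
    rw [← Unitization.inr_add, add_sub_cancel, inr_nupow x hm0, ← pow_mul] at h
    rw [inr_nupow x (by omega), inr_nupow x hn, ← h]
    congr 1
    rw [add_comm, ← Nat.succ_mul, Nat.succ_eq_add_one, Nat.sub_add_cancel hm0]
end

section
/- Let R be a ring and let a, b be elements of R. Suppose there are positive integers m and ℓ such that (x + a)^m = x^m for all x in R and (x + b)^ℓ = x^ℓ for all x in R. Then (a + b)^{ℓ·m} = 0; in particular, a + b is nilpotent. Consequently, in a nilperiod ring the set of nilpotent elements is closed under addition. -/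
theorem nupow_add {R : Type*} [NonUnitalRing R] (x : R) (m n : ℕ) :
    nupow x (m + 1 + (n + 1)) = nupow x (m + 1) * nupow x (n + 1) := by
  induction n with
  | zero => rfl
  | succ n ih =>
    change nupow x (m + 1 + (n + 1)) * x = nupow x (m + 1) * (nupow x (n + 1) * x)
    rw [ih, mul_assoc]

theorem nupow_mul {R : Type*} [NonUnitalRing R] (x : R) {m n : ℕ} (hm : 0 < m) :
    nupow x (m * n) = nupow (nupow x m) n := by
  obtain ⟨m, rfl⟩ := Nat.exists_eq_succ_of_ne_zero hm.ne'
  match n with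
  | 0 => rfl
  | n + 1 =>
    induction n with
    | zero => simp [nupow]
    | succ n ih =>
      change _ = nupow (nupow x (m + 1)) (n + 1) * nupow x (m + 1)
      rw [← ih]
      rw [← Nat.succ_eq_add_one m, show m.succ * (n + 1 + 1) = m * (n + 1) + n + 1 + (m + 1) by
        rw [Nat.succ_eq_add_one]; ring,
        show m.succ * (n + 1) = m * (n + 1) + n + 1 by rw [Nat.succ_eq_add_one]; ring]
      exact nupow_add x (m * (n + 1) + n) m

theorem nupow_zero_left {R : Type*} [NonUnitalRing R] (n : ℕ) : nupow (0 : R) n = 0 := by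
  match n with
  | 0 => rfl
  | 1 => rfl
  | n + 2 => exact mul_zero _

theorem nupow_add_eq_zero_of_periods {R : Type*} [NonUnitalRing R] {a b : R} {m l : ℕ}
    (hm : 0 < m) (hl : 0 < l) (ha : ∀ x : R, nupow (x + a) m = nupow x m)
    (hb : ∀ x : R, nupow (x + b) l = nupow x l) : nupow (a + b) (l * m) = 0 := by
  rw [add_comm a b, mul_comm l m, nupow_mul _ hm, ha, ← nupow_mul _ hm, mul_comm m l,
    nupow_mul _ hl, ← zero_add b, hb, nupow_zero_left, nupow_zero_left]

/-- If `(x + a)^m = x^m` and `(x + b)^ℓ = x^ℓ` hold for all `x` in a (not necessarily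
commutative or unital) ring `R`, then `(a + b)^{ℓ·m} = 0`, so `a + b` is nilpotent.
Consequently, in a nilperiod ring the set of nilpotent elements is closed
under addition. -/
theorem stmt3 {R : Type*} [NonUnitalRing R] :
    (∀ (a b : R) (m l : ℕ), 0 < m → 0 < l →
      (∀ x : R, nupow (x + a) m = nupow x m) →
      (∀ x : R, nupow (x + b) l = nupow x l) →
      nupow (a + b) (l * m) = 0 ∧ ∃ k : ℕ, 0 < k ∧ nupow (a + b) k = 0) ∧
    ((∀ r : R, r ≠ 0 → (∃ k : ℕ, 0 < k ∧ nupow r k = 0) →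
        ∃ n : ℕ, 0 < n ∧ ∀ x : R, nupow (x + r) n = nupow x n) →
      ∀ a b : R, (∃ k : ℕ, 0 < k ∧ nupow a k = 0) → (∃ k : ℕ, 0 < k ∧ nupow b k = 0) →
        ∃ k : ℕ, 0 < k ∧ nupow (a + b) k = 0) := by
  refine ⟨fun a b m l hm hl ha hb => ?_, fun h a b ha hb => ?_⟩
  · have h0 := nupow_add_eq_zero_of_periods hm hl ha hb
    exact ⟨h0, l * m, Nat.mul_pos hl hm, h0⟩
  · by_cases ha0 : a = 0
    · simpa [ha0] using hb
    by_cases hb0 : b = 0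
    · simpa [hb0] using ha
    obtain ⟨m, hm, ha'⟩ := h a ha0 ha
    obtain ⟨l, hl, hb'⟩ := h b hb0 hb
    exact ⟨l * m, Nat.mul_pos hl hm, nupow_add_eq_zero_of_periods hm hl ha' hb'⟩
end

section
/- Let R be a commutative ring, let p be a prime number, and suppose R contains a nilpotent element r whose additive order is finite and divisible by p. Then for every positive integer n divisible by p, the power map x ↦ x^n is periodic over R; that is, there exists a nonzero element s of R (which can be taken nilpotent with s^2 = 0 and p • s = 0) such that (x + s)^n = x^n for all x in R. -/
theorem nupow_nsmul {R : Type*} [NonUnitalCommRing R] (m : ℕ) (x : R) (k : ℕ) :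
    nupow (m • x) k = m ^ k • nupow x k := by
  induction k with
  | zero => simp [nupow]
  | succ k ih =>
    cases k with
    | zero => simp [nupow]
    | succ k => simp only [nupow, ih, smul_mul_smul_comm, pow_succ]

/-- If `s` squares to zero, then `(x + s)^n = x^n + n x^(n-1) s` for `n ≥ 2`. -/
theorem nupow_add_of_mul_self_eq_zero {R : Type*} [NonUnitalCommRing R] {s : R}
    (hs : s * s = 0) (x : R) (n : ℕ) :
    nupow (x + s) (n + 2) = nupow x (n + 2) + (n + 2) • (nupow x (n + 1) * s) := by
  induction n with
  | zero =>
    simp only [nupow, zero_add, add_mul, mul_add, hs, mul_comm s x, two_nsmul]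
    abel
  | succ n ih =>
    rw [nupow, ih]
    have h₁ : nupow x (n + 1) * s * s = 0 := by rw [mul_assoc, hs, mul_zero]
    have h₂ : nupow x (n + 1) * s * x = nupow x (n + 2) * s := by
      rw [nupow, mul_right_comm]
    simp only [add_mul, mul_add, smul_mul_assoc, h₁, h₂, smul_zero, add_zero]
    rw [show nupow x (n + 1 + 2) = nupow x (n + 2) * x from rfl, add_assoc,
      show n + 1 + 2 = (n + 2) + 1 from rfl, succ_nsmul _ (n + 2)]

theorem exists_ne_zero_mul_self_eq_zero {R : Type*} [NonUnitalCommRing R] (p : ℕ) {t : R}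
    (ht : t ≠ 0) (hpt : p • t = 0) (k : ℕ) (hk : nupow t (k + 1) = 0) :
    ∃ s : R, s ≠ 0 ∧ s * s = 0 ∧ p • s = 0 := by
  induction k with
  | zero => exact absurd hk ht
  | succ k ih =>
    by_cases h : nupow t (k + 1) = 0
    · exact ih h
    · cases k with
      | zero => exact ⟨t, ht, hk, hpt⟩
      | succ k =>
        refine ⟨nupow t (k + 2), h, ?_, ?_⟩
        · have hk' : nupow t (k + 2) * t = 0 := hk
          nth_rewrite 2 [nupow]
          rw [mul_comm (nupow t (k + 1)), ← mul_assoc, hk', zero_mul]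
        · rw [nupow, ← mul_smul_comm, hpt, mul_zero]

/-- If a commutative (not necessarily unital) ring `R` contains a nilpotent element `r`
of finite additive order divisible by a prime `p`, then for every positive integer `n`
divisible by `p` the power map `x ↦ x^n` is periodic: it has a nonzero period `s`,
which may be taken with `s^2 = 0` and `p • s = 0`. -/
theorem stmt6 {R : Type*} [NonUnitalCommRing R] (p : ℕ) (hp : p.Prime) (r : R)
    (hrnil : ∃ k : ℕ, 0 < k ∧ nupow r k = 0)
    (hord : addOrderOf r ≠ 0 ∧ p ∣ addOrderOf r) :
    ∀ n : ℕ, 0 < n → p ∣ n →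
      ∃ s : R, s ≠ 0 ∧ nupow s 2 = 0 ∧ p • s = 0 ∧
        ∀ x : R, nupow (x + s) n = nupow x n := by
  obtain ⟨k, hk, hrk⟩ := hrnil
  obtain ⟨hord₀, m, hm⟩ := hord
  obtain ⟨k, rfl⟩ := Nat.exists_eq_succ_of_ne_zero hk.ne'
  have hm₀ : 0 < m := Nat.pos_of_ne_zero fun h => hord₀ (by rw [hm, h, mul_zero])
  have ht : m • r ≠ 0 := fun h => by
    have hle := Nat.le_of_dvd hm₀ (addOrderOf_dvd_of_nsmul_eq_zero h)
    rw [hm] at hle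
    nlinarith [hp.two_le]
  have hpt : p • m • r = 0 := by
    rw [← mul_nsmul', ← hm, addOrderOf_nsmul_eq_zero]
  have htk : nupow (m • r) (k + 1) = 0 := by
    rw [nupow_nsmul, hrk, smul_zero]
  obtain ⟨s, hs, hss, hps⟩ := exists_ne_zero_mul_self_eq_zero p ht hpt k htk
  intro n hn hpn
  refine ⟨s, hs, hss, hps, fun x => ?_⟩
  obtain ⟨n, rfl⟩ := Nat.exists_eq_add_of_le' (hp.two_le.trans (Nat.le_of_dvd hn hpn))
  obtain ⟨c, hc⟩ := hpn
  rw [nupow_add_of_mul_self_eq_zero hss, ← mul_smul_comm, hc, mul_comm p c, mul_nsmul', hps,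
    smul_zero, mul_zero, add_zero]
end

section
/- Let R be a finite commutative ring with identity, let n be a positive integer, and suppose s is a nonzero element of R such that (x + s)^n = x^n for all x in R. Then n is not coprime with the additive order of s; that is, gcd(n, addOrder(s)) > 1. (Moreover such an s is necessarily nilpotent.) -/
/-- In a finite commutative ring with identity, if a nonzero `s` satisfies
`(x + s)^n = x^n` for all `x` (with `n` positive), then `n` is not coprime with the
additive order of `s`; moreover such an `s` is necessarily nilpotent. -/
theorem stmt7 {R : Type*} [CommRing R] [Fintype R] (n : ℕ) (hn : 0 < n) (s : R)
    (hs : s ≠ 0) (h : ∀ x : R, (x + s) ^ n = x ^ n) :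
    1 < Nat.gcd n (addOrderOf s) ∧ IsNilpotent s := by
  have hnil : IsNilpotent s := ⟨n, by simpa [hn.ne'] using h 0⟩
  refine ⟨?_, hnil⟩
  by_contra hgcd
  have hcop : Nat.gcd n (addOrderOf s) = 1 :=
    le_antisymm (not_lt.mp hgcd) (Nat.gcd_pos_of_pos_left _ hn)
  obtain ⟨r, hr⟩ := Polynomial.powAddExpansion 1 s n
  rw [h 1] at hr
  simp only [one_pow, mul_one] at hr
  obtain ⟨a, b, hab⟩ := Nat.isCoprime_iff_coprime.mpr hcop
  have hbez : (a : R) * n + b * (addOrderOf s : R) = 1 := by exact_mod_cast congrArg (Int.cast : ℤ → R) hab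
  have hord : (addOrderOf s : R) * s = 0 := by
    rw [← nsmul_eq_mul, addOrderOf_nsmul_eq_zero]
  have hunit : IsUnit (1 + a * r * s) :=
    IsNilpotent.isUnit_one_add ((Commute.all _ _).isNilpotent_mul_left hnil)
  refine hs (hunit.mul_right_eq_zero.mp ?_)
  linear_combination (-(a : R)) * hr - s * hbez + b * hord
end

section
/- Let R be a finite commutative ring with identity and let n be a positive integer. Then the power map x ↦ x^n is periodic over R (i.e., there exists a nonzero s in R with (x + s)^n = x^n for all x in R) if and only if there exist a prime p dividing n and a nilpotent element r of R whose additive order is divisible by p. -/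
/-- A nonzero nilpotent element has a nonzero multiple of square zero. -/
lemma IsNilpotent.exists_mul_ne_zero_sq_eq_zero {R : Type*} [CommRing R] {a : R}
    (ha : IsNilpotent a) (h0 : a ≠ 0) : ∃ b : R, a * b ≠ 0 ∧ (a * b) ^ 2 = 0 := by
  have : Nontrivial R := ⟨a, 0, h0⟩
  obtain ⟨k, hk⟩ : ∃ k, nilpotencyClass a = k + 2 := by
    have h1 : nilpotencyClass a ≠ 0 := (pos_nilpotencyClass_iff.mpr ha).ne'
    have h2 : nilpotencyClass a ≠ 1 := fun h ↦ h0 (nilpotencyClass_eq_one.mp h)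
    exact ⟨nilpotencyClass a - 2, by omega⟩
  obtain ⟨hz, hne⟩ := (nilpotencyClass_eq_succ_iff (k := k + 1)).mp hk
  refine ⟨a ^ k, by rwa [← pow_succ'], ?_⟩
  rw [← pow_succ', ← pow_mul]
  exact pow_eq_zero_of_le (by omega) hz

/-- If `n` is coprime to the additive order of a nilpotent `s` and `1 + s` is an `n`-th root of
unity, then `s = 0`. -/
lemma IsNilpotent.eq_zero_of_one_add_pow_eq_one {R : Type*} [CommRing R] {s : R} {n : ℕ}
    (hs : IsNilpotent s) (hn : n.Coprime (addOrderOf s)) (h : (1 + s) ^ n = 1) : s = 0 := by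
  obtain ⟨u, hu⟩ := Polynomial.powAddExpansion 1 s n
  obtain ⟨m, hm⟩ := exists_nsmul_eq_self_of_coprime hn
  rw [nsmul_eq_mul, nsmul_eq_mul] at hm
  simp only [h, one_pow, mul_one] at hu
  have hunit : IsUnit (1 + m * u * s) :=
    ((Commute.all _ s).isNilpotent_mul_left hs).isUnit_one_add
  exact hunit.mul_right_eq_zero.mp (by linear_combination -m * hu - hm)

/-- Over a finite commutative ring with identity, the power map `x ↦ x^n` (with `n`
positive) is periodic if and only if some prime `p` divides `n` and divides the
additive order of some nilpotent element of `R`. -/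
theorem stmt8 {R : Type*} [CommRing R] [Fintype R] (n : ℕ) (hn : 0 < n) :
    (∃ s : R, s ≠ 0 ∧ ∀ x : R, (x + s) ^ n = x ^ n) ↔
      ∃ p : ℕ, p.Prime ∧ p ∣ n ∧ ∃ r : R, IsNilpotent r ∧ p ∣ addOrderOf r := by
  constructor
  · rintro ⟨s, hs0, hs⟩
    have hnil : IsNilpotent s := ⟨n, by simpa [hn.ne'] using hs 0⟩
    by_contra hp
    refine hs0 (hnil.eq_zero_of_one_add_pow_eq_one ?_ (by simpa using hs 1))
    exact Nat.coprime_of_dvd fun p hpp hpn hps ↦ hp ⟨p, hpp, hpn, s, hnil, hps⟩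
  · rintro ⟨p, hp, ⟨m, rfl⟩, r, hr, k, hk⟩
    have hpos : 0 < p * k := hk ▸ addOrderOf_pos r
    have hkpos : 0 < k := Nat.pos_of_mul_pos_left hpos
    have hne : (k : R) * r ≠ 0 := by
      rw [← nsmul_eq_mul]
      exact nsmul_ne_zero_of_lt_addOrderOf hkpos.ne' (hk ▸ lt_mul_left hkpos hp.one_lt)
    have hpr : (p : R) * (k * r) = 0 := by
      rw [← mul_assoc, ← Nat.cast_mul, ← hk, ← nsmul_eq_mul, addOrderOf_nsmul_eq_zero]
    obtain ⟨b, hb, hb2⟩ :=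
      ((Commute.all _ r).isNilpotent_mul_left hr).exists_mul_ne_zero_sq_eq_zero hne
    refine ⟨_, hb, fun x ↦ ?_⟩
    obtain ⟨c, hc⟩ := Polynomial.powAddExpansion x (k * r * b) (p * m)
    rw [hc]
    push_cast
    linear_combination m * x ^ (p * m - 1) * b * hpr + c * hb2
end

section
/- Let R be a J-ring, i.e., a ring in which for every x there is an integer m > 1 with x^m = x. Then no power map over R is periodic: for every positive integer n and every nonzero r in R there exists x in R with (x + r)^n ≠ x^n. -/
theorem inr_nupow_succ {R : Type*} [NonUnitalRing R] (x : R) (n : ℕ) :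
    (Unitization.inr (nupow x (n + 1)) : Unitization ℤ R) = Unitization.inr x ^ (n + 1) := by
  induction n with
  | zero => simp [nupow]
  | succ n ih => rw [pow_succ, ← ih, ← Unitization.inr_mul, nupow]

theorem eq_zero_of_pow_eq_zero_of_pow_eq_self {M : Type*} [MonoidWithZero M] {a : M} {m n : ℕ}
    (hm : 1 < m) (ha : a ^ m = a) (h0 : a ^ n = 0) : a = 0 := by
  have h (k : ℕ) : a ^ m ^ k = a := by
    induction k with
    | zero => simp
    | succ k ih => rw [pow_succ, pow_mul, ih, ha]
  rw [← h n]
  exact pow_eq_zero_of_le (Nat.lt_pow_self hm).le h0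

/-- In a J-ring (every element `x` satisfies `x^m = x` for some `m > 1`), no power map
is periodic: for every positive `n` and nonzero `r` some `x` has `(x + r)^n ≠ x^n`. -/
theorem stmt9 {R : Type*} [NonUnitalRing R]
    (hJ : ∀ x : R, ∃ m : ℕ, 1 < m ∧ nupow x m = x) :
    ∀ n : ℕ, 0 < n → ∀ r : R, r ≠ 0 → ∃ x : R, nupow (x + r) n ≠ nupow x n := by
  intro n hn r hr
  refine ⟨0, fun h => hr ?_⟩
  rw [zero_add, nupow_zero_left] at h
  obtain ⟨m, hm, hrm⟩ := hJ r
  obtain ⟨n, rfl⟩ := Nat.exists_eq_add_one.mpr hn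
  obtain ⟨m, rfl⟩ := Nat.exists_eq_add_one.mpr (zero_lt_one.trans hm)
  have hpow : (Unitization.inr r : Unitization ℤ R) ^ (m + 1) = Unitization.inr r := by
    rw [← inr_nupow_succ, hrm]
  have hzero : (Unitization.inr r : Unitization ℤ R) ^ (n + 1) = 0 := by
    rw [← inr_nupow_succ, h, Unitization.inr_zero]
  have hr0 := eq_zero_of_pow_eq_zero_of_pow_eq_self (M := Unitization ℤ R) hm hpow hzero
  exact Unitization.inr_injective (hr0.trans (Unitization.inr_zero ℤ).symm)
end

section
/- Let R be a ring such that x·r = 0 and r·x = 0 for every x in R and every nilpotent element r of R. Then for every integer n ≥ 2, an element r of R satisfies (x + r)^n = x^n for all x in R if and only if r is nilpotent; in particular every nonzero nilpotent element is a period of each power map x ↦ x^n with n ≥ 2. -/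
theorem nupow_add_two {R : Type*} [NonUnitalRing R] (x : R) (n : ℕ) :
    nupow x (n + 2) = nupow x (n + 1) * x := rfl

theorem nupow_zero_base {R : Type*} [NonUnitalRing R] : ∀ n : ℕ, nupow (0 : R) n = 0
  | 0 => rfl
  | 1 => rfl
  | n + 2 => by rw [nupow_add_two, mul_zero]

/-- Adding an element which annihilates the ring on both sides does not change powers with
exponent at least `2`. -/
theorem nupow_add_of_annihilates {R : Type*} [NonUnitalRing R] {r : R}
    (hr : ∀ x : R, x * r = 0 ∧ r * x = 0) (x : R) (m : ℕ) :
    nupow (x + r) (m + 2) = nupow x (m + 2) := by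
  induction m with
  | zero =>
    change (x + r) * (x + r) = x * x
    rw [mul_add, (hr _).1, add_mul, (hr _).2, add_zero, add_zero]
  | succ m ih =>
    rw [nupow_add_two, ih, mul_add, (hr _).1, add_zero, ← nupow_add_two]

/-- In a ring which annihilates its nilpotent elements on both sides, for every
integer `n ≥ 2` an element `r` satisfies `(x + r)^n = x^n` for all `x` if and only if
`r` is nilpotent; in particular every nonzero nilpotent element is a period of each
power map `x ↦ x^n` with `n ≥ 2`. -/
theorem stmt12 {R : Type*} [NonUnitalRing R]
    (hann : ∀ x r : R, (∃ k : ℕ, 0 < k ∧ nupow r k = 0) → x * r = 0 ∧ r * x = 0)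
    (n : ℕ) (hn : 2 ≤ n) (r : R) :
    (∀ x : R, nupow (x + r) n = nupow x n) ↔ ∃ k : ℕ, 0 < k ∧ nupow r k = 0 := by
  constructor
  · intro h
    refine ⟨n, by omega, ?_⟩
    have h0 := h 0
    rwa [zero_add, nupow_zero_base] at h0
  · intro hr x
    obtain ⟨m, rfl⟩ := Nat.exists_eq_add_of_le' hn
    exact nupow_add_of_annihilates (fun y => hann y r hr) x m
end

section
/- Let R be the direct product over all i ∈ ℕ of the rings ℤ/p_i²ℤ, where p_i denotes the i-th prime number, and let r ∈ R be the element whose i-th coordinate is the residue class of p_i in ℤ/p_i²ℤ. Then r is nonzero, r² = 0 (so r is nilpotent of index 2), and r is not a period of any power map: for every positive integer n there exists x in R with (x + r)^n ≠ x^n. -/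
theorem one_add_pow_of_sq_eq_zero {A : Type*} [CommRing A] {e : A} (he : e ^ 2 = 0) (n : ℕ) :
    (1 + e) ^ n = 1 + n * e := by
  induction n with
  | zero => simp
  | succ n ih =>
    rw [pow_succ, ih]
    push_cast
    linear_combination (n : A) * he

theorem ZMod.natCast_mul_self_ne_zero {p n : ℕ} (hp : 0 < p) (hn : 0 < n) (hnp : n < p) :
    (n : ZMod (p ^ 2)) * p ≠ 0 := by
  intro h
  rw [← Nat.cast_mul, ZMod.natCast_eq_zero_iff, sq] at h
  exact Nat.not_dvd_of_pos_of_lt hn hnp (Nat.dvd_of_mul_dvd_mul_right hp h)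


/-- In the direct product `R = ∏_{i ∈ ℕ} ℤ/p_i²ℤ` (where `p_i` is the `i`-th prime),
the element `r` whose `i`-th coordinate is the class of `p_i` is nonzero and satisfies
`r² = 0`, yet `r` is not a period of any power map: for every positive `n` there is an
`x` with `(x + r)^n ≠ x^n`. -/
theorem stmt13 (r : ∀ i : ℕ, ZMod ((Nat.nth Nat.Prime i) ^ 2))
    (hr : ∀ i : ℕ, r i = ((Nat.nth Nat.Prime i : ℕ) : ZMod ((Nat.nth Nat.Prime i) ^ 2))) :
    r ≠ 0 ∧ r ^ 2 = 0 ∧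
      ∀ n : ℕ, 0 < n → ∃ x : ∀ i : ℕ, ZMod ((Nat.nth Nat.Prime i) ^ 2),
        (x + r) ^ n ≠ x ^ n := by
  have hsq : ∀ i, r i ^ 2 = 0 := fun i => by
    rw [hr, ← Nat.cast_pow, ZMod.natCast_self]
  have hper : ∀ n : ℕ, 0 < n → (1 + r) ^ n ≠ 1 ^ n := by
    intro n hn h
    obtain ⟨p, hnp, hp⟩ := Nat.exists_infinite_primes (n + 1)
    obtain ⟨i, rfl⟩ : ∃ i, Nat.nth Nat.Prime i = p := ⟨_, Nat.nth_count hp⟩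
    have h' := congrFun h i
    simp only [Pi.pow_apply, Pi.add_apply, Pi.one_apply, one_pow] at h'
    rw [one_add_pow_of_sq_eq_zero (hsq i), add_eq_left, hr] at h'
    exact ZMod.natCast_mul_self_ne_zero hp.pos hn hnp h'
  refine ⟨?_, funext hsq, fun n hn => ⟨1, hper n hn⟩⟩
  rintro rfl
  exact hper 1 one_pos (by simp)
end

section
/- Let n and m be positive integers. Then the power map x ↦ x^m is periodic over ℤ/nℤ — that is, there exists a nonzero s ∈ ℤ/nℤ with (x + s)^m = x^m for all x ∈ ℤ/nℤ — if and only if there exists a prime p such that p² divides n and p divides m. -/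
/-- If `p ∣ a`, `p ∤ m` and `p ^ k ∣ (1 + a) ^ m - 1`, then `p ^ k ∣ a`. -/
theorem Int.prime_pow_dvd_of_dvd_one_add_pow_sub_one {p k m : ℕ} {a : ℤ} (hp : p.Prime)
    (hpa : (p : ℤ) ∣ a) (hpm : ¬ p ∣ m) (h : (p : ℤ) ^ k ∣ (1 + a) ^ m - 1) :
    (p : ℤ) ^ k ∣ a := by
  have hS : ¬ (p : ℤ) ∣ ∑ i ∈ Finset.range m, (1 + a) ^ i := by
    rw [← ZMod.intCast_zmod_eq_zero_iff_dvd _ p] at *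
    rwa [Int.cast_sum, Finset.sum_congr rfl
      (g := fun _ => (1 : ZMod p)) (fun i _ => by simp [hpa]), Finset.sum_const,
      Finset.card_range, nsmul_one, ZMod.natCast_eq_zero_iff]
  rw [← mul_geom_sum, add_sub_cancel_left] at h
  have hcop : IsCoprime (p : ℤ) (∑ i ∈ Finset.range m, (1 + a) ^ i) :=
    (Nat.prime_iff_prime_int.mp hp).coprime_iff_not_dvd.mpr hS
  exact hcop.pow_left.dvd_of_dvd_mul_right h

/-- If `s ^ 2 = 0` and `m * s = 0`, then `s` is a period of `x ↦ x ^ m`. -/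
theorem add_pow_eq_pow_of_sq_eq_zero {R : Type*} [CommRing R] {s : R} {m : ℕ}
    (hs : s ^ 2 = 0) (hms : (m : R) * s = 0) (x : R) : (x + s) ^ m = x ^ m := by
  obtain ⟨c, hc⟩ := Polynomial.powAddExpansion x s m
  rw [hc, hs]
  linear_combination x ^ (m - 1) * hms

/-- The power map `x ↦ x^m` is periodic over `ℤ/nℤ` if and only if some prime `p`
satisfies `p² ∣ n` and `p ∣ m`. -/
theorem stmt15 (n m : ℕ) (hn : 0 < n) (hm : 0 < m) :
    (∃ s : ZMod n, s ≠ 0 ∧ ∀ x : ZMod n, (x + s) ^ m = x ^ m) ↔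
      ∃ p : ℕ, p.Prime ∧ p ^ 2 ∣ n ∧ p ∣ m := by
  constructor
  · rintro ⟨s, hs, h⟩
    obtain ⟨a, rfl⟩ := ZMod.intCast_surjective s
    have hna : ¬ n ∣ a.natAbs := by
      rwa [Ne, ZMod.intCast_zmod_eq_zero_iff_dvd, Int.natCast_dvd] at hs
    rw [Nat.dvd_iff_prime_pow_dvd_dvd] at hna
    push Not at hna
    obtain ⟨p, k, hp, hkn, hka⟩ := hna
    have hka' : ¬ (p : ℤ) ^ k ∣ a := by
      rwa [← Nat.cast_pow, Int.natCast_dvd]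
    have hk0 : k ≠ 0 := by
      rintro rfl
      simp at hka
    have h0 : (n : ℤ) ∣ a ^ m := by
      rw [← ZMod.intCast_zmod_eq_zero_iff_dvd]
      simpa [hm.ne'] using h 0
    have h1 : (n : ℤ) ∣ (1 + a) ^ m - 1 := by
      rw [← ZMod.intCast_zmod_eq_zero_iff_dvd]
      simpa [sub_eq_zero] using h 1
    have hpa : (p : ℤ) ∣ a :=
      (Nat.prime_iff_prime_int.mp hp).dvd_of_dvd_pow
        ((Int.natCast_dvd_natCast.mpr ((dvd_pow_self p hk0).trans hkn)).trans h0)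
    have hk1 : k ≠ 1 := by
      rintro rfl
      exact hka' (by simpa using hpa)
    refine ⟨p, hp, (pow_dvd_pow p (by omega)).trans hkn, ?_⟩
    by_contra hpm
    refine hka' (Int.prime_pow_dvd_of_dvd_one_add_pow_sub_one hp hpa hpm (dvd_trans ?_ h1))
    exact_mod_cast hkn
  · rintro ⟨p, hp, ⟨c, rfl⟩, ⟨d, rfl⟩⟩
    refine ⟨((p * c : ℕ) : ZMod (p ^ 2 * c)), ?_, add_pow_eq_pow_of_sq_eq_zero ?_ ?_⟩
    · rw [Ne, ZMod.natCast_eq_zero_iff]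
      intro hdvd
      have hpc : 0 < p * c := Nat.mul_pos hp.pos (Nat.pos_of_mul_pos_left hn)
      have := Nat.le_of_dvd hpc hdvd
      nlinarith [hp.two_le]
    · rw [← Nat.cast_pow, ZMod.natCast_eq_zero_iff]
      exact ⟨c, by ring⟩
    · rw [← Nat.cast_mul, ZMod.natCast_eq_zero_iff]
      exact ⟨d, by ring⟩
end

section
/- Let n ≥ 2 be an integer, let λ(n) denote the exponent of the group of units of ℤ/nℤ (the Carmichael function), and let E(n) denote the largest exponent occurring in the prime factorization of n. Then x^{E(n) + λ(n)} = x^{E(n)} for all x ∈ ℤ/nℤ; moreover λ(n) is the least positive integer e such that x^{E(n) + e} = x^{E(n)} for all x, and E(n) is the least positive integer m such that x^{m + λ(n)} = x^m for all x. In particular the exponential period of ℤ/nℤ is λ(n) and its onset of exponential periodicity is E(n). -/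
/-- The Carmichael function is monotone for divisibility. -/
theorem ZMod.exponent_units_dvd_of_dvd {d n : ℕ} [NeZero n] (h : d ∣ n) :
    Monoid.exponent (ZMod d)ˣ ∣ Monoid.exponent (ZMod n)ˣ :=
  MonoidHom.exponent_dvd (f := ZMod.unitsMap h) (ZMod.unitsMap_surjective h)

theorem ZMod.pow_add_exponent_units_eq {n N : ℕ} [NeZero n]
    (hN : ∀ p, p.Prime → n.factorization p ≤ N) (x : ZMod n) :
    x ^ (N + Monoid.exponent (ZMod n)ˣ) = x ^ N := by
  obtain ⟨a, rfl⟩ := ZMod.natCast_zmod_surjective x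
  have key : n ∣ ((a : ℤ) ^ (N + Monoid.exponent (ZMod n)ˣ) - (a : ℤ) ^ N).natAbs := by
    rw [Nat.dvd_iff_prime_pow_dvd_dvd]
    intro p k hp hk
    rw [← Int.natCast_dvd, pow_add, ← mul_sub_one]
    by_cases hpa : p ∣ a
    · have hkN : k ≤ N :=
        ((hp.pow_dvd_iff_le_factorization (NeZero.ne n)).1 hk).trans (hN p hp)
      have h : p ^ k ∣ a ^ N := (pow_dvd_pow p hkN).trans (pow_dvd_pow_of_dvd hpa N)
      exact Dvd.dvd.mul_right (by exact_mod_cast h) _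
    · have hcop : a.Coprime (p ^ k) := ((hp.coprime_iff_not_dvd.2 hpa).symm).pow_right k
      have hu : ZMod.unitOfCoprime a hcop ^ Monoid.exponent (ZMod n)ˣ = 1 :=
        Monoid.exponent_dvd_iff_forall_pow_eq_one.1 (ZMod.exponent_units_dvd_of_dvd hk) _
      have hu' : (a : ZMod (p ^ k)) ^ Monoid.exponent (ZMod n)ˣ = 1 := by
        simpa using congrArg Units.val hu
      refine Dvd.dvd.mul_left ?_ _
      rw [← ZMod.intCast_zmod_eq_zero_iff_dvd]
      push_cast
      rw [hu', sub_self]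
  rw [← Int.natCast_dvd, ← ZMod.intCast_zmod_eq_zero_iff_dvd] at key
  push_cast at key
  exact sub_eq_zero.1 key

theorem ZMod.exponent_units_dvd_of_pow_add_eq {n N e : ℕ}
    (h : ∀ x : ZMod n, x ^ (N + e) = x ^ N) : Monoid.exponent (ZMod n)ˣ ∣ e := by
  refine Monoid.exponent_dvd_of_forall_pow_eq_one fun u => ?_
  have hu : u ^ (N + e) = u ^ N := Units.ext (by simpa using h u)
  rwa [pow_add, mul_eq_left] at hu

theorem ZMod.factorization_le_of_pow_add_eq {n m e p : ℕ} (hp : p.Prime) (he : e ≠ 0)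
    (h : (p : ZMod n) ^ (m + e) = (p : ZMod n) ^ m) : n.factorization p ≤ m := by
  have hdvd : (n : ℤ) ∣ (p : ℤ) ^ m * ((p : ℤ) ^ e - 1) := by
    rw [← ZMod.intCast_zmod_eq_zero_iff_dvd]
    push_cast
    rw [mul_sub_one, ← pow_add, h, sub_self]
  have hcop : IsCoprime ((p : ℤ) ^ n.factorization p) ((p : ℤ) ^ e - 1) := by
    refine IsCoprime.pow_left ⟨(p : ℤ) ^ (e - 1), -1, ?_⟩
    rw [pow_sub_one_mul he]
    ring
  have hpow : ((p : ℤ) ^ n.factorization p) ∣ n := by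
    exact_mod_cast Nat.ordProj_dvd n p
  have hle : p ^ n.factorization p ∣ p ^ m := by
    exact_mod_cast hcop.dvd_of_dvd_mul_right (hpow.trans hdvd)
  exact (Nat.pow_dvd_pow_iff_le_right hp.one_lt).1 hle

/-- For `n ≥ 2`, letting `λ(n)` be the exponent of `(ℤ/nℤ)ˣ` (the Carmichael function)
and `E(n)` the largest exponent in the prime factorization of `n`, we have
`x^{E(n)+λ(n)} = x^{E(n)}` for all `x ∈ ℤ/nℤ`; moreover `λ(n)` is the least positive
integer `e` with `x^{E(n)+e} = x^{E(n)}` for all `x`, and `E(n)` is the least positive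
integer `m` with `x^{m+λ(n)} = x^m` for all `x`. Thus the exponential period of
`ℤ/nℤ` is `λ(n)` and its onset of exponential periodicity is `E(n)`. -/
theorem stmt16 (n : ℕ) (hn : 2 ≤ n)
    (lam E : ℕ) (hlam : lam = Monoid.exponent (ZMod n)ˣ)
    (hE : E = n.factorization.support.sup fun p => n.factorization p) :
    (∀ x : ZMod n, x ^ (E + lam) = x ^ E) ∧
    (∀ e : ℕ, 0 < e → (∀ x : ZMod n, x ^ (E + e) = x ^ E) → lam ≤ e) ∧
    (∀ m : ℕ, 0 < m → (∀ x : ZMod n, x ^ (m + lam) = x ^ m) → E ≤ m) := by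
  have : NeZero n := ⟨by omega⟩
  subst hlam hE
  refine ⟨ZMod.pow_add_exponent_units_eq fun p _ => ?_, fun e he h =>
    Nat.le_of_dvd he (ZMod.exponent_units_dvd_of_pow_add_eq h), fun m _ h =>
    Finset.sup_le fun p hp => ZMod.factorization_le_of_pow_add_eq
      (Nat.prime_of_mem_primeFactors hp) Monoid.exponent_ne_zero_of_finite (h p)⟩
  by_cases hp : p ∈ n.factorization.support
  · exact Finset.le_sup (f := fun p => n.factorization p) hp
  · simp [Finsupp.notMem_support_iff.1 hp]
end

section
/- Let K be a field and n a positive integer. Then no power map over the matrix ring M_n(K) is periodic: for every positive integer m and every nonzero matrix A ∈ M_n(K), there exists X ∈ M_n(K) such that (X + A)^m ≠ X^m. -/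
/-- A nonzero nilpotent endomorphism `f` admits a vector `v` with `f v ≠ 0` and `f (f v) = 0`. -/
theorem exists_apply_ne_zero_apply_apply_eq_zero {R M : Type*} [Semiring R] [AddCommMonoid M]
    [Module R M] {f : Module.End R M} (hf : IsNilpotent f) (h0 : f ≠ 0) :
    ∃ v, f v ≠ 0 ∧ f (f v) = 0 := by
  by_contra! h
  obtain ⟨w, hw⟩ : ∃ w, f w ≠ 0 := by
    by_contra! hw
    exact h0 (LinearMap.ext hw)
  obtain ⟨k, hk⟩ := hf
  have iterate_ne_zero : ∀ j, (f ^ (j + 1)) w ≠ 0 := by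
    intro j
    induction j with
    | zero => simpa using hw
    | succ j ih =>
      rw [pow_succ', Module.End.mul_apply] at ih
      rw [pow_succ', pow_succ', Module.End.mul_apply, Module.End.mul_apply]
      exact h _ ih
  exact iterate_ne_zero k (by rw [pow_succ', hk]; simp)

/-- A nonzero nilpotent endomorphism of a vector space can be made non-nilpotent by adding a
square-zero endomorphism. -/
theorem exists_sq_eq_zero_not_isNilpotent_add {K V : Type*} [Field K] [AddCommGroup V]
    [Module K V] {f : Module.End K V} (hf : IsNilpotent f) (h0 : f ≠ 0) :
    ∃ g : Module.End K V, g ^ 2 = 0 ∧ ¬ IsNilpotent (g + f) := by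
  obtain ⟨v, hv, hv2⟩ := exists_apply_ne_zero_apply_apply_eq_zero hf h0
  have hmem : f v ∉ Submodule.span K {v} := by
    intro hm
    obtain ⟨c, hc⟩ := Submodule.mem_span_singleton.1 hm
    have hcf : c • f v = 0 := by rw [← map_smul, hc, hv2]
    rcases smul_eq_zero.1 hcf with rfl | h
    · exact hv (by rw [← hc, zero_smul])
    · exact hv h
  obtain ⟨φ, hφ, hle⟩ := Submodule.exists_le_ker_of_notMem hmem
  have hφv : φ v = 0 := hle (Submodule.mem_span_singleton_self v)
  refine ⟨((φ (f v))⁻¹ • φ).smulRight v, ?_, ?_⟩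
  · ext x
    simp [pow_two, hφv]
  · rintro ⟨k, hk⟩
    set g : Module.End K V := ((φ (f v))⁻¹ • φ).smulRight v + f with hg
    have hfix : (g ^ 2) v = v := by
      simp [hg, pow_two, hφv, hv2, hφ]
    have hiter : ((g ^ 2) ^ k) v = v := by
      rw [Module.End.pow_apply]
      exact Function.iterate_fixed hfix k
    rw [← pow_mul, mul_comm, pow_mul, hk] at hiter
    exact hv (by rw [← hiter]; simp)

/-- No power map over a matrix ring `M_n(K)` over a field is periodic: for every
positive `m` and every nonzero matrix `A` there is an `X` with `(X + A)^m ≠ X^m`. -/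
theorem stmt17 {K : Type*} [Field K] (n : ℕ) (hn : 0 < n) (m : ℕ) (hm : 0 < m)
    (A : Matrix (Fin n) (Fin n) K) (hA : A ≠ 0) :
    ∃ X : Matrix (Fin n) (Fin n) K, (X + A) ^ m ≠ X ^ m := by
  by_contra! h
  have hAm : A ^ m = 0 := by simpa [hm.ne'] using h 0
  let e : Matrix (Fin n) (Fin n) K ≃ₐ[K] Module.End K (Fin n → K) := Matrix.toLinAlgEquiv'
  obtain ⟨g, hg, hnil⟩ := exists_sq_eq_zero_not_isNilpotent_add (f := e A)
    ⟨m, by rw [← map_pow, hAm, map_zero]⟩ (by simpa using hA)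
  have hperiod : (g + e A) ^ m = g ^ m := by
    simpa using congrArg e (h (e.symm g))
  have hm2 : 2 ≤ m := by
    by_contra hlt
    obtain rfl : m = 1 := by omega
    exact hA (by simpa using hAm)
  exact hnil ⟨m, by rw [hperiod, pow_eq_zero_of_le hm2 hg]⟩
end

section
/- Let F be a finite field and n a positive integer, and let e denote the exponent of the general linear group GL(n, F). Then every matrix A ∈ M_n(F) satisfies A^{n + e} = A^n; moreover, e is the least positive integer e' such that A^{n + e'} = A^n for all A ∈ M_n(F), and n is the least positive integer m such that A^{m + e} = A^m for all A ∈ M_n(F). In other words, the exponential period of M_n(F) is the exponent of GL(n, F) and its onset of exponential periodicity is n. -/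
open Polynomial in
/-- If every unit of `M_n(F)` satisfies `u ^ e = 1`, then every matrix satisfies
`A ^ (n + e) = A ^ n`: write the characteristic polynomial as `X ^ k * g` with `g` coprime to `X`
and evaluate at `A` a polynomial congruent to `X` modulo `g` and to `1` modulo `X`. -/
theorem Matrix.pow_add_eq_pow_of_units_pow_eq_one {F : Type*} [Field F] {n e : ℕ}
    (h : ∀ u : GL (Fin n) F, u ^ e = 1) (A : Matrix (Fin n) (Fin n) F) :
    A ^ (n + e) = A ^ n := by
  classical
  obtain ⟨g, hg, hXg⟩ :=
    exists_eq_pow_rootMultiplicity_mul_and_not_dvd A.charpoly A.charpoly_monic.ne_zero 0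
  set k := A.charpoly.rootMultiplicity 0
  rw [C_0, sub_zero] at hg hXg
  have hk : k ≤ n := by
    have h1 := A.charpoly.card_roots'
    rw [A.charpoly_natDegree_eq_dim, Fintype.card_fin] at h1
    exact (count_roots A.charpoly ▸ Multiset.count_le_card 0 _).trans h1
  obtain ⟨u, v, huv⟩ : IsCoprime X g := (irreducible_X.coprime_iff_not_dvd).2 hXg
  set b : F[X] := X + (1 - X) * (v * g) with hb
  have hbX : IsCoprime b X := ⟨1, u * (1 - X), by rw [hb]; linear_combination (1 - X) * huv⟩
  have hbg : IsCoprime b g :=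
    ⟨u, v - u * (1 - X) * v, by rw [hb]; linear_combination huv⟩
  obtain ⟨p, q, hpq⟩ : IsCoprime b A.charpoly := hg ▸ hbX.pow_right.mul_right hbg
  have hunit : aeval A b * aeval A p = 1 := by
    have := congrArg (aeval A) hpq
    rw [map_add, map_mul, map_mul, A.aeval_self_charpoly, mul_zero, add_zero, map_one] at this
    rw [← map_mul, mul_comm, map_mul, this]
  have hpow : aeval A b ^ e = 1 :=
    congrArg Units.val (h ⟨aeval A b, aeval A p, hunit, mul_eq_one_comm.1 hunit⟩)
  have hdvd : A.charpoly ∣ X ^ n * (b ^ e - X ^ e) := by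
    rw [hg]
    refine mul_dvd_mul (pow_dvd_pow X hk) (dvd_trans ?_ (sub_dvd_pow_sub_pow b X e))
    exact ⟨(1 - X) * v, by rw [hb]; ring⟩
  obtain ⟨c, hc⟩ := hdvd
  have := congrArg (aeval A) hc
  rw [map_mul, map_mul, A.aeval_self_charpoly, zero_mul, map_sub, map_pow, map_pow, map_pow,
    aeval_X, hpow, mul_sub, mul_one, ← pow_add, sub_eq_zero] at this
  exact this.symm

/-- Powers of the nilpotent Jordan block. -/
theorem Matrix.pow_nilpotentJordanBlock_apply {R : Type*} [Semiring R] {n : ℕ} (k : ℕ)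
    (i j : Fin n) :
    ((Matrix.of fun i j : Fin n => if (i : ℕ) + 1 = j then (1 : R) else 0) ^ k) i j =
      if (i : ℕ) + k = j then 1 else 0 := by
  induction k generalizing j with
  | zero => simp [Matrix.one_apply, Fin.ext_iff]
  | succ k ih =>
    rw [pow_succ, Matrix.mul_apply]
    simp only [ih, Matrix.of_apply, ite_mul, one_mul, zero_mul]
    by_cases hik : (i : ℕ) + k < n
    · rw [Finset.sum_eq_single ⟨i + k, hik⟩]
      · simp [add_assoc]
      · intro l _ hl
        exact if_neg fun h => hl (Fin.ext h.symm)
      · simp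
    · rw [if_neg (by omega)]
      exact Finset.sum_eq_zero fun l _ => if_neg (by omega)


/-- For a finite field `F` and `n ≥ 1`, with `e` the exponent of `GL(n, F)`: every
`A ∈ M_n(F)` satisfies `A^{n+e} = A^n`; `e` is the least positive integer `e'` with
`A^{n+e'} = A^n` for all `A`; and `n` is the least positive integer `m` with
`A^{m+e} = A^m` for all `A`. That is, the exponential period of `M_n(F)` is the
exponent of `GL(n, F)` and its onset of exponential periodicity is `n`. -/
theorem stmt18 {F : Type*} [Field F] [Fintype F] (n : ℕ) (hn : 0 < n)
    (e : ℕ) (he : e = Monoid.exponent (GL (Fin n) F)) :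
    (∀ A : Matrix (Fin n) (Fin n) F, A ^ (n + e) = A ^ n) ∧
    (∀ e' : ℕ, 0 < e' → (∀ A : Matrix (Fin n) (Fin n) F, A ^ (n + e') = A ^ n) → e ≤ e') ∧
    (∀ m : ℕ, 0 < m → (∀ A : Matrix (Fin n) (Fin n) F, A ^ (m + e) = A ^ m) → n ≤ m) := by
  subst he
  refine ⟨Matrix.pow_add_eq_pow_of_units_pow_eq_one Monoid.pow_exponent_eq_one,
    fun e' he' h => ?_, fun m _ h => ?_⟩
  · refine Nat.le_of_dvd he' (Monoid.exponent_dvd_of_forall_pow_eq_one fun u => ?_)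
    have hu : u ^ (n + e') = u ^ n := Units.ext (by simpa using h u)
    rwa [pow_add, mul_eq_left] at hu
  · by_contra! hm
    have hpos : 0 < Monoid.exponent (GL (Fin n) F) :=
      Nat.pos_of_ne_zero Monoid.exponent_ne_zero_of_finite
    have := congrFun₂ (h (Matrix.of fun i j => if (i : ℕ) + 1 = j then 1 else 0)) ⟨0, hn⟩ ⟨m, hm⟩
    rw [Matrix.pow_nilpotentJordanBlock_apply, Matrix.pow_nilpotentJordanBlock_apply] at this
    simp [hpos.ne'] at this
end

section
/- Let R be a commutative ring, let p be a prime number, and suppose R contains a nilpotent element r whose additive order is finite and divisible by p. Then R contains a nonzero element s with s² = 0 whose additive order is exactly p. -/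
theorem nupow_succ_mul_nupow_succ {R : Type*} [NonUnitalRing R] (x : R) (m n : ℕ) :
    nupow x (m + 1) * nupow x (n + 1) = nupow x (m + n + 2) := by
  induction n with
  | zero => rfl
  | succ n ih =>
    rw [nupow_add_two x n, ← mul_assoc, ih]
    exact (nupow_add_two x (m + n + 1)).symm

theorem nsmul_nupow {R : Type*} [NonUnitalRing R] (c : ℕ) (x : R) (n : ℕ) :
    nupow (c • x) (n + 1) = c ^ (n + 1) • nupow x (n + 1) := by
  induction n with
  | zero => simp [nupow]
  | succ n ih =>
    rw [nupow_add_two, nupow_add_two, ih, smul_mul_smul_comm, ← pow_succ]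

theorem nsmul_nupow_eq_zero {R : Type*} [NonUnitalRing R] {c : ℕ} {x : R}
    (h : c • x = 0) (n : ℕ) : c • nupow x n = 0 := by
  match n with
  | 0 => exact smul_zero c
  | 1 => exact h
  | n + 2 => rw [nupow_add_two, ← mul_smul_comm, h, mul_zero]

/-- The last nonzero power of a nonzero nilpotent element squares to zero. -/
theorem exists_nupow_ne_zero_mul_self_eq_zero {R : Type*} [NonUnitalRing R] {x : R}
    (hx : x ≠ 0) {n : ℕ} (h : nupow x (n + 1) = 0) :
    ∃ m, nupow x m ≠ 0 ∧ nupow x m * nupow x m = 0 := by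
  induction n with
  | zero => exact absurd h hx
  | succ n ih =>
    by_cases hn : nupow x (n + 1) = 0
    · exact ih hn
    · refine ⟨n + 1, hn, ?_⟩
      cases n with
      | zero => exact h
      | succ n =>
        rw [nupow_succ_mul_nupow_succ, show n + 1 + (n + 1) + 2 = n + (n + 2) + 2 by ring,
          ← nupow_succ_mul_nupow_succ, h, mul_zero]

/-- If a commutative (not necessarily unital) ring `R` contains a nilpotent element
`r` whose additive order is finite and divisible by a prime `p`, then `R` contains a
nonzero element `s` with `s² = 0` whose additive order is exactly `p`. -/
theorem stmt19 {R : Type*} [NonUnitalCommRing R] (p : ℕ) (hp : p.Prime) (r : R)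
    (hrnil : ∃ k : ℕ, 0 < k ∧ nupow r k = 0)
    (hord : addOrderOf r ≠ 0 ∧ p ∣ addOrderOf r) :
    ∃ s : R, s ≠ 0 ∧ nupow s 2 = 0 ∧ addOrderOf s = p := by
  obtain ⟨k, hk, hrk⟩ := hrnil
  obtain ⟨n, rfl⟩ := Nat.exists_eq_succ_of_ne_zero hk.ne'
  obtain ⟨h0, c, hc⟩ := hord
  have hp' : Fact p.Prime := ⟨hp⟩
  have hc0 : c ≠ 0 := by
    rintro rfl
    exact h0 (by simpa using hc)
  have hcr : addOrderOf (c • r) = p := by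
    rw [addOrderOf_nsmul_of_dvd hc0 (Dvd.intro_left p hc.symm), hc,
      Nat.mul_div_cancel _ (Nat.pos_of_ne_zero hc0)]
  have hne : c • r ≠ 0 := by
    intro h
    rw [h, addOrderOf_zero] at hcr
    exact hp.one_lt.ne hcr
  have hnil : nupow (c • r) (n + 1) = 0 := by
    rw [nsmul_nupow, hrk, smul_zero]
  obtain ⟨m, hm, hsq⟩ := exists_nupow_ne_zero_mul_self_eq_zero hne hnil
  have hpr : p • (c • r) = 0 := addOrderOf_dvd_iff_nsmul_eq_zero.mp hcr.dvd
  exact ⟨nupow (c • r) m, hm, hsq, addOrderOf_eq_prime (nsmul_nupow_eq_zero hpr m) hm⟩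
end
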